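/- arXiv:1106.2172 — 2 statements merged into one kernel-verified Lean document; each statement's English description precedes it below -/
import Mathlib

section
/- Let k be a field and L a field extension of k. Let N, r, e, m be natural numbers with 1 ≤ e ≤ N, and set n = N − e. Let f_1, …, f_r ∈ k[x_1, …, x_N] and let J = (∂f_j/∂x_i) be their r × N Jacobian matrix. Let α = (α_1, …, α_N) ∈ (L[[t]])^N satisfy f_j(α) = 0 in L[[t]] for all j, and let β = (β_1, …, β_N) be the reduction of α modulo t^{m+1}, with entries in L[t]/(t^{m+1}). Assume: (i) every (e+1) × (e+1) minor of the matrix J(α) (the Jacobian evaluated at α, with entries in L[[t]]) is zero; (ii) there is a natural number a with a ≤ m such that some e × e minor of J(α) has t-adic order a and every e × e minor of J(α) is either zero or has t-adic order at least a. Then: (1) the kernel of the L-linear map (L[t]/(t^{m+1}))^N → (L[t]/(t^{m+1}))^r given by the matrix J(β) has dimension n(m+1) + a as an L-vector space; and (2) the map w ↦ (β_1 + w_1 ε, …, β_N + w_N ε) is a bijection from this kernel onto the set of N-tuples b ∈ (DualNumber(L[t]/(t^{m+1})))^N such that f_j(b) = 0 for all j and each b_i reduces to β_i modulo ε. -/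
set_option synthInstance.maxHeartbeats 800000
set_option maxHeartbeats 1600000

open TrivSqZeroExt

/-- The set of `k × k` minors of a matrix `M`: determinants of submatrices obtained by
choosing `k` rows and `k` columns. -/
def Matrix.minorsSet {R : Type*} [CommRing R] {r c : ℕ}
    (M : Matrix (Fin r) (Fin c) R) (k : ℕ) : Set R :=
  { d | ∃ (ρ : Fin k → Fin r) (γ : Fin k → Fin c),
      Function.Injective ρ ∧ Function.Injective γ ∧ d = (M.submatrix ρ γ).det }

/-- Reduction modulo `t^(m+1)`: the natural ring homomorphism
`L⟦t⟧ → L[t]/(t^(m+1))`, as a function. -/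
noncomputable def truncMod (L : Type*) [Field L] (m : ℕ) (f : PowerSeries L) :
    Polynomial L ⧸ Ideal.span {(Polynomial.X : Polynomial L) ^ (m + 1)} :=
  Ideal.Quotient.mk _ (PowerSeries.trunc (m + 1) f)

/-- The `r × N` Jacobian matrix `(∂f j/∂x i)` of a family of multivariate polynomials over
`k`, evaluated at a point `x` with coordinates in a commutative `k`-algebra `S`. -/
noncomputable def jacobianAt {k : Type*} [CommSemiring k] {S : Type*} [CommSemiring S]
    [Algebra k S] {N r : ℕ} (f : Fin r → MvPolynomial (Fin N) k) (x : Fin N → S) :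
    Matrix (Fin r) (Fin N) S :=
  Matrix.of fun j i => MvPolynomial.aeval x (MvPolynomial.pderiv i (f j))

namespace Matrix

section Minors

variable {R : Type*} [CommRing R] {r c : ℕ}

lemma det_submatrix_mem_minorsSet_or_eq_zero {ι : Type*} [Fintype ι] [DecidableEq ι] {k : ℕ}
    (σ : Fin k ≃ ι) (A : Matrix (Fin r) (Fin c) R) (ρ : ι → Fin r) (γ : ι → Fin c) :
    (A.submatrix ρ γ).det ∈ A.minorsSet k ∨ (A.submatrix ρ γ).det = 0 := by
  by_cases hρ : Function.Injective ρ
  · by_cases hγ : Function.Injective γ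
    · refine Or.inl ⟨ρ ∘ σ, γ ∘ σ, hρ.comp σ.injective, hγ.comp σ.injective, ?_⟩
      rw [← submatrix_submatrix, det_submatrix_equiv_self]
    · obtain ⟨i, j, hij, hne⟩ := Function.not_injective_iff.1 hγ
      exact Or.inr (det_zero_of_column_eq hne fun l => by simp [hij])
  · obtain ⟨i, j, hij, hne⟩ := Function.not_injective_iff.1 hρ
    exact Or.inr (det_zero_of_row_eq hne (by ext l; simp [hij]))

lemma transpose_minorsSet_subset (A : Matrix (Fin r) (Fin c) R) (k : ℕ) :
    Aᵀ.minorsSet k ⊆ A.minorsSet k := by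
  rintro d ⟨ρ, γ, hρ, hγ, rfl⟩
  exact ⟨γ, ρ, hγ, hρ, by rw [← transpose_submatrix, det_transpose]⟩

/-- If the nonzero determinant of a square submatrix divides all minors of its size, then the rows
of that submatrix span all rows of the matrix restricted to the chosen columns. -/
lemma exists_eq_mul_submatrix [IsDomain R] {e : ℕ} (A : Matrix (Fin r) (Fin c) R)
    (ρ : Fin e → Fin r) (γ : Fin e → Fin c) (hd : (A.submatrix ρ γ).det ≠ 0)
    (hdvd : ∀ x ∈ A.minorsSet e, (A.submatrix ρ γ).det ∣ x) :
    ∃ P : Matrix (Fin r) (Fin e) R, A.submatrix id γ = P * A.submatrix ρ γ ∧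
      (1 : Matrix (Fin r) (Fin r) R).submatrix ρ id * P = 1 := by
  set D := A.submatrix ρ γ with hD
  have key : ∀ j i, ∃ p, (A.submatrix id γ * D.adjugate) j i = D.det * p := by
    intro j i
    have h : (A.submatrix id γ * D.adjugate) j i
        = (A.submatrix (Function.update ρ i j) γ).det := by
      have h1 : (A.submatrix id γ * D.adjugate) j i = (D.updateRow i (A.submatrix id γ j)).det := by
        rw [← cramer_transpose_apply, cramer_eq_adjugate_mulVec, ← adjugate_transpose,
          mulVec_transpose]
        rfl
      rw [h1]
      congr 1
      ext s t
      by_cases hs : s = i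
      · subst hs; simp
      · simp [hD, hs]
    rw [h]
    rcases det_submatrix_mem_minorsSet_or_eq_zero (Equiv.refl (Fin e)) A
      (Function.update ρ i j) γ with hm | h0
    · exact hdvd _ hm
    · exact ⟨0, by simp [h0]⟩
  choose P hP using key
  have hP' : A.submatrix id γ * D.adjugate = D.det • of P := by
    ext j i; simpa using hP j i
  refine ⟨of P, ?_, ?_⟩
  · apply smul_right_injective _ hd
    simp only
    rw [← Matrix.smul_mul, ← hP', Matrix.mul_assoc, adjugate_mul]
    simp
  · apply smul_right_injective _ hd
    simp only
    rw [← Matrix.mul_smul, ← hP', ← Matrix.mul_assoc]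
    have : (1 : Matrix (Fin r) (Fin r) R).submatrix ρ id * A.submatrix id γ = D := by
      ext i j; simp [Matrix.mul_apply, hD, Matrix.one_apply]
    rw [this, mul_adjugate]

lemma det_smul_eq_of_minorsSet_succ [IsDomain R] {e : ℕ} (A : Matrix (Fin r) (Fin c) R)
    (ρ : Fin e → Fin r) (γ : Fin e → Fin c) (hd : (A.submatrix ρ γ).det ≠ 0)
    (hbig : ∀ x ∈ A.minorsSet (e + 1), x = 0) :
    (A.submatrix ρ γ).det • A =
      A.submatrix id γ * (A.submatrix ρ γ).adjugate * A.submatrix ρ id := by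
  ext j l
  set D := A.submatrix ρ γ with hD
  let b : Matrix (Fin e) Unit R := A.submatrix ρ fun _ => l
  let w : Matrix Unit (Fin e) R := A.submatrix (fun _ => j) γ
  let x : Matrix Unit Unit R := A.submatrix (fun _ => j) fun _ => l
  have hM : (fromBlocks D b w x).det = 0 := by
    have h : fromBlocks D b w x =
        A.submatrix (Sum.elim ρ fun _ => j) (Sum.elim γ fun _ => l) := by
      ext (i | i) (k | k) <;> rfl
    rw [h]
    have σ : Fin (e + 1) ≃ Fin e ⊕ Unit := Fintype.equivOfCardEq (by simp)
    exact (det_submatrix_mem_minorsSet_or_eq_zero σ A _ _).elim (hbig _) id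
  have hmul : fromBlocks D b w x * fromBlocks 1 (-(D.adjugate * b)) 0 (D.det • 1) =
      fromBlocks D 0 w (D.det • x - w * D.adjugate * b) := by
    rw [fromBlocks_multiply]
    congr 1
    · simp
    · rw [Matrix.mul_neg, ← Matrix.mul_assoc, mul_adjugate]; simp
    · simp
    · rw [Matrix.mul_neg, ← Matrix.mul_assoc]; simp [sub_eq_neg_add]
  have hdet := congrArg Matrix.det hmul
  rw [det_mul, hM, zero_mul, det_fromBlocks_zero₁₂] at hdet
  have h0 := (mul_eq_zero.1 hdet.symm).resolve_left hd
  rw [det_unique, sub_apply, sub_eq_zero] at h0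
  exact h0

/-- A matrix of rank `e` over a domain, one of whose `e × e` minors divides all the others,
factors through the corresponding submatrix by maps with one-sided inverses. -/
lemma exists_factorization_submatrix [IsDomain R] {e : ℕ} (A : Matrix (Fin r) (Fin c) R)
    (ρ : Fin e → Fin r) (γ : Fin e → Fin c) (hd : (A.submatrix ρ γ).det ≠ 0)
    (hdvd : ∀ x ∈ A.minorsSet e, (A.submatrix ρ γ).det ∣ x)
    (hbig : ∀ x ∈ A.minorsSet (e + 1), x = 0) :
    ∃ (P : Matrix (Fin r) (Fin e) R) (P' : Matrix (Fin e) (Fin r) R)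
      (Q : Matrix (Fin e) (Fin c) R) (Q' : Matrix (Fin c) (Fin e) R),
      A = P * A.submatrix ρ γ * Q ∧ P' * P = 1 ∧ Q * Q' = 1 := by
  obtain ⟨P, hP, hP'⟩ := exists_eq_mul_submatrix A ρ γ hd hdvd
  obtain ⟨T, hT, hT'⟩ := exists_eq_mul_submatrix Aᵀ γ ρ
    (by rwa [← transpose_submatrix, det_transpose]) (fun x hx => by
      rw [← transpose_submatrix, det_transpose]
      exact hdvd x (transpose_minorsSet_subset A e hx))
  refine ⟨P, _, Tᵀ, _, ?_, hP', by rw [← transpose_inj, transpose_mul, transpose_transpose,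
    transpose_one, transpose_transpose, hT']⟩
  have hQ : A.submatrix ρ id = A.submatrix ρ γ * Tᵀ := by
    rw [← transpose_inj, transpose_mul, transpose_transpose]
    exact hT
  apply smul_right_injective _ hd
  simp only
  rw [det_smul_eq_of_minorsSet_succ A ρ γ hd hbig, hP, hQ, Matrix.mul_assoc P, mul_adjugate,
    Matrix.mul_smul, Matrix.mul_one, Matrix.smul_mul, Matrix.mul_assoc]

end Minors

lemma finrank_ker_mulVecLin_mul_mul {L S : Type*} [Field L] [CommRing S] [Algebra L S]
    [Module.Finite L S] {r c e : ℕ} {P : Matrix (Fin r) (Fin e) S} {P' : Matrix (Fin e) (Fin r) S}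
    {Q : Matrix (Fin e) (Fin c) S} {Q' : Matrix (Fin c) (Fin e) S} (D : Matrix (Fin e) (Fin e) S)
    (hP : P' * P = 1) (hQ : Q * Q' = 1) :
    Module.finrank L (LinearMap.ker ((P * D * Q).mulVecLin.restrictScalars L)) +
        e * Module.finrank L S =
      Module.finrank L (LinearMap.ker (D.mulVecLin.restrictScalars L)) +
        c * Module.finrank L S := by
  have hker : LinearMap.ker ((P * D * Q).mulVecLin.restrictScalars L) =
      LinearMap.ker ((D.mulVecLin.restrictScalars L) ∘ₗ (Q.mulVecLin.restrictScalars L)) := by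
    ext v
    simp only [LinearMap.mem_ker, LinearMap.coe_restrictScalars, mulVecLin_apply,
      LinearMap.comp_apply, ← mulVec_mulVec]
    refine ⟨fun h => ?_, fun h => by rw [h, mulVec_zero]⟩
    have := congrArg (P' *ᵥ ·) h
    simpa [mulVec_mulVec, ← Matrix.mul_assoc, hP] using this
  have hrange : LinearMap.range
      ((D.mulVecLin.restrictScalars L) ∘ₗ (Q.mulVecLin.restrictScalars L)) =
      LinearMap.range (D.mulVecLin.restrictScalars L) := by
    apply LinearMap.range_comp_of_range_eq_top
    rw [LinearMap.range_eq_top]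
    intro v
    exact ⟨Q' *ᵥ v, by simp [mulVec_mulVec, hQ]⟩
  have h1 := LinearMap.finrank_range_add_finrank_ker
    ((D.mulVecLin.restrictScalars L) ∘ₗ (Q.mulVecLin.restrictScalars L))
  have h2 := LinearMap.finrank_range_add_finrank_ker (D.mulVecLin.restrictScalars L)
  rw [hrange, Module.finrank_pi_fintype] at h1
  rw [Module.finrank_pi_fintype] at h2
  simp only [Finset.sum_const, Finset.card_univ, Fintype.card_fin, smul_eq_mul] at h1 h2
  rw [hker]
  omega

lemma finrank_ker_mulVecLin_diagonal {L S : Type*} [Field L] [CommRing S] [Algebra L S]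
    [Module.Finite L S] {e : ℕ} (d : Fin e → S) :
    Module.finrank L (LinearMap.ker ((diagonal d).mulVecLin.restrictScalars L)) =
      ∑ i, Module.finrank L (LinearMap.ker (LinearMap.mulLeft L (d i))) := by
  let E : LinearMap.ker ((diagonal d).mulVecLin.restrictScalars L) ≃ₗ[L]
      (∀ i, LinearMap.ker (LinearMap.mulLeft L (d i))) :=
    { toFun := fun v i => ⟨v.1 i, by
        have h : (diagonal d *ᵥ v.1) i = 0 := congrFun (LinearMap.mem_ker.1 v.2) i
        rwa [mulVec_diagonal] at h⟩
      invFun := fun v => ⟨fun i => (v i).1, by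
        rw [LinearMap.mem_ker]
        ext i
        exact (mulVec_diagonal d _ i).trans (LinearMap.mem_ker.1 (v i).2)⟩
      map_add' := fun _ _ => rfl
      map_smul' := fun _ _ => rfl
      left_inv := fun _ => rfl
      right_inv := fun _ => rfl }
  rw [E.finrank_eq, Module.finrank_pi_fintype]

/-- Smith normal form of a square matrix with nonzero determinant over a principal ideal domain. -/
lemma exists_mul_eq_mul_diagonal {R : Type*} [CommRing R] [IsDomain R] [IsPrincipalIdealRing R]
    {e : ℕ} (D : Matrix (Fin e) (Fin e) R) (hD : D.det ≠ 0) :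
    ∃ (U V : Matrix (Fin e) (Fin e) R) (d : Fin e → R),
      IsUnit U ∧ IsUnit V ∧ D = U * diagonal d * V := by
  have hinj : Function.Injective D.mulVecLin := by
    rw [← LinearMap.ker_eq_bot, LinearMap.ker_eq_bot']
    intro v hv
    exact eq_zero_of_mulVec_eq_zero hD hv
  let φ := LinearEquiv.ofInjective D.mulVecLin hinj
  obtain ⟨b, d, ab, hab⟩ := Submodule.exists_smith_normal_form_of_rank_eq
    (Pi.basisFun R (Fin e)) (N := LinearMap.range D.mulVecLin) φ.finrank_eq.symm
  let v := ab.map φ.symm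
  let s := Pi.basisFun R (Fin e)
  have hv : ∀ i, D *ᵥ v i = d i • b i := by
    intro i
    rw [← hab i]
    have : φ (v i) = ab i := by simp [v]
    rw [← this]
    rfl
  have hDV : D * s.toMatrix v = s.toMatrix b * diagonal d := by
    ext j i
    have h := congrFun (hv i) j
    rw [mul_diagonal]
    simpa [s, mulVec, dotProduct, Matrix.mul_apply, Module.Basis.toMatrix_apply, mul_comm] using h
  refine ⟨s.toMatrix b, v.toMatrix s, d, ?_, ?_, ?_⟩
  · have := s.invertibleToMatrix b
    exact isUnit_of_invertible _
  · have := v.invertibleToMatrix s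
    exact isUnit_of_invertible _
  · rw [← hDV, Matrix.mul_assoc, Module.Basis.toMatrix_mul_toMatrix_flip, Matrix.mul_one]

end Matrix

/-- Reduction modulo `t^(m+1)` as a ring homomorphism. -/
noncomputable def truncModHom (L : Type*) [Field L] (m : ℕ) :
    PowerSeries L →+* Polynomial L ⧸ Ideal.span {(Polynomial.X : Polynomial L) ^ (m + 1)} where
  toFun := truncMod L m
  map_one' := by simp [truncMod, PowerSeries.trunc_one]
  map_zero' := by simp [truncMod]
  map_add' f g := by simp [truncMod]
  map_mul' f g := by
    simp only [truncMod]
    rw [← map_mul, Ideal.Quotient.eq, Ideal.mem_span_singleton, Polynomial.X_pow_dvd_iff]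
    intro d hd
    have h := congrArg (Polynomial.coeff · d) (PowerSeries.trunc_trunc_mul_trunc (n := m + 1) f g)
    simp only [PowerSeries.coeff_trunc, hd, if_true, ← Polynomial.coe_mul,
      Polynomial.coeff_coe] at h
    rw [Polynomial.coeff_sub, h, PowerSeries.coeff_trunc, if_pos hd, sub_self]

lemma truncModHom_X_pow {L : Type*} [Field L] {m o : ℕ} (ho : o ≤ m) :
    truncModHom L m (PowerSeries.X ^ o) = Ideal.Quotient.mk _ (Polynomial.X ^ o) := by
  change Ideal.Quotient.mk _ _ = _
  congr 1
  rw [← Polynomial.coe_X, ← Polynomial.coe_pow,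
    PowerSeries.trunc_coe_eq_self (by simpa using Nat.lt_succ_of_le ho)]

lemma jacobianAt_map {k S T : Type*} [CommSemiring k] [CommSemiring S] [CommSemiring T]
    [Algebra k S] [Algebra k T] {N r : ℕ} (f : Fin r → MvPolynomial (Fin N) k) (x : Fin N → S)
    (φ : S →ₐ[k] T) :
    jacobianAt f (fun i => φ (x i)) = (jacobianAt f x).map φ := by
  ext j i
  simp only [jacobianAt, Matrix.of_apply, Matrix.map_apply]
  exact (MvPolynomial.comp_aeval_apply x φ _).symm

lemma PowerSeries.exists_isUnit_eq_X_pow_mul {L : Type*} [Field L] {c : PowerSeries L} {o : ℕ}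
    (hc : c.order = o) : ∃ u : PowerSeries L, IsUnit u ∧ c = X ^ o * u := by
  have h0 : c ≠ 0 := by
    rintro rfl
    simp at hc
  refine ⟨divXPowOrder c, isUnit_divided_by_X_pow_order h0, ?_⟩
  have h := X_pow_order_mul_divXPowOrder (f := c)
  rw [hc] at h
  exact h.symm

section Trunc

variable {L : Type*} [Field L] (m : ℕ)

instance finite_polynomial_quotient_X_pow : Module.Finite L
    (Polynomial L ⧸ Ideal.span {(Polynomial.X : Polynomial L) ^ (m + 1)}) :=
  (Polynomial.monic_X_pow (R := L) (m + 1)).finite_quotient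

lemma finrank_polynomial_quotient_X_pow (o : ℕ) : Module.finrank L
    (Polynomial L ⧸ Ideal.span {(Polynomial.X : Polynomial L) ^ o}) = o := by
  rw [finrank_quotient_span_eq_natDegree' (Polynomial.monic_X_pow o), Polynomial.natDegree_X_pow]

lemma finrank_ker_mulLeft_truncModHom (c : PowerSeries L) (o : ℕ) (hc : c.order = o)
    (ho : o ≤ m) :
    Module.finrank L (LinearMap.ker (LinearMap.mulLeft L (truncModHom L m c))) = o := by
  obtain ⟨u, hu, hcu⟩ := PowerSeries.exists_isUnit_eq_X_pow_mul hc
  have hrange : LinearMap.range (LinearMap.mulLeft L (truncModHom L m c)) =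
      ((Ideal.span {(Polynomial.X : Polynomial L) ^ o}).map
        (Ideal.Quotient.mk (Ideal.span {(Polynomial.X : Polynomial L) ^ (m + 1)}))).restrictScalars
        L := by
    rw [Ideal.map_span, Set.image_singleton, ← truncModHom_X_pow ho,
      ← Ideal.span_singleton_mul_right_unit (hu.map (truncModHom L m)), ← map_mul, ← hcu]
    ext y
    simp [Ideal.mem_span_singleton, Dvd.dvd, eq_comm]
  have hle : Ideal.span {(Polynomial.X : Polynomial L) ^ (m + 1)} ≤
      Ideal.span {(Polynomial.X : Polynomial L) ^ o} := by
    rw [Ideal.span_singleton_le_span_singleton]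
    exact pow_dvd_pow _ (by omega)
  have h1 := LinearMap.finrank_range_add_finrank_ker (LinearMap.mulLeft L (truncModHom L m c))
  have h2 := Submodule.finrank_quotient_add_finrank
    (LinearMap.range (LinearMap.mulLeft L (truncModHom L m c)))
  have h3 : Module.finrank L (_ ⧸ LinearMap.range (LinearMap.mulLeft L (truncModHom L m c))) =
      o := by
    rw [hrange]
    exact (DoubleQuot.quotQuotEquivQuotOfLEₐ L hle).toLinearEquiv.finrank_eq.trans
      (finrank_polynomial_quotient_X_pow o)
  omega

lemma finrank_ker_mulVecLin_map_truncModHom {e a : ℕ}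
    (D : Matrix (Fin e) (Fin e) (PowerSeries L)) (hD : D.det.order = a) (ha : a ≤ m) :
    Module.finrank L
      (LinearMap.ker ((D.map (truncModHom L m)).mulVecLin.restrictScalars L)) = a := by
  have hD0 : D.det ≠ 0 := by
    rintro h
    simp [h] at hD
  obtain ⟨U, V, d, hU, hV, hUV⟩ := D.exists_mul_eq_mul_diagonal hD0
  have hsum : ∑ i, (d i).order = a := by
    have hUo := PowerSeries.order_zero_of_unit ((Matrix.isUnit_iff_isUnit_det U).1 hU)
    have hVo := PowerSeries.order_zero_of_unit ((Matrix.isUnit_iff_isUnit_det V).1 hV)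
    rw [← PowerSeries.order_prod, ← hD, hUV, Matrix.det_mul, Matrix.det_mul, Matrix.det_diagonal,
      PowerSeries.order_mul, PowerSeries.order_mul, hUo, hVo, zero_add, add_zero]
  have hd : ∀ i, (d i).order = ((d i).order.toNat : ℕ∞) := by
    intro i
    refine (ENat.natCast_toNat fun h => ?_).symm
    have := Finset.single_le_sum (f := fun i => (d i).order) (fun _ _ => zero_le)
      (Finset.mem_univ i)
    simp [h, hsum] at this
  have hsum' : ∑ i, (d i).order.toNat = a := by
    have : ((∑ i, (d i).order.toNat : ℕ) : ℕ∞) = a := by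
      rw [← hsum, Nat.cast_sum]
      exact Finset.sum_congr rfl fun i _ => (hd i).symm
    exact_mod_cast this
  have hU' : IsUnit (U.map (truncModHom L m)) := hU.map (truncModHom L m).mapMatrix
  have hV' : IsUnit (V.map (truncModHom L m)) := hV.map (truncModHom L m).mapMatrix
  obtain ⟨P', hP'⟩ := hU'.exists_left_inv
  obtain ⟨Q', hQ'⟩ := hV'.exists_right_inv
  have key := Matrix.finrank_ker_mulVecLin_mul_mul (L := L)
    (Matrix.diagonal fun i => truncModHom L m (d i)) hP' hQ'
  have hmap : D.map (truncModHom L m) = U.map (truncModHom L m) *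
      (Matrix.diagonal fun i => truncModHom L m (d i)) * V.map (truncModHom L m) := by
    rw [hUV, Matrix.map_mul, Matrix.map_mul, Matrix.diagonal_map (map_zero _)]
  rw [hmap, Nat.add_right_cancel key, Matrix.finrank_ker_mulVecLin_diagonal, ← hsum']
  refine Finset.sum_congr rfl fun i _ => finrank_ker_mulLeft_truncModHom m _ _ (hd i) ?_
  exact (Finset.single_le_sum (f := fun i => (d i).order.toNat) (fun _ _ => Nat.zero_le _)
    (Finset.mem_univ i)).trans (hsum'.le.trans ha)

end Trunc

/-- First-order Taylor expansion over the dual numbers. -/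
lemma MvPolynomial.aeval_inl_add_inr {k S : Type*} [CommRing k] [CommRing S] [Algebra k S]
    {N : ℕ} (x w : Fin N → S) (p : MvPolynomial (Fin N) k) :
    aeval (fun i => (inl (x i) + inr (w i) : DualNumber S)) p =
      inl (aeval x p) + inr (∑ i, aeval x (pderiv i p) * w i) := by
  induction p using MvPolynomial.induction_on with
  | C c => simp [TrivSqZeroExt.algebraMap_eq_inl']
  | add p q hp hq =>
    simp only [map_add, hp, hq, add_mul, Finset.sum_add_distrib, inl_add, inr_add]
    abel
  | mul_X p j hp =>
    have : ∀ i, aeval x (pderiv i (p * X j)) * w i =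
        x j * (aeval x (pderiv i p) * w i) + if i = j then aeval x p * w i else 0 := by
      intro i
      rw [pderiv_mul, pderiv_X]
      by_cases h : i = j
      · subst h; simp; ring
      · simp [h, Ne.symm h]; ring
    simp only [this, map_mul, hp, aeval_X, Finset.sum_add_distrib, ← Finset.mul_sum]
    ext <;> simp [mul_comm]

/-- The tangent vectors at a solution `x` of a polynomial system are the solutions over the dual
numbers reducing to `x`. -/
lemma bijOn_ker_jacobianAt_dualNumber {L k S : Type*} [CommRing k] [CommRing S] [Algebra k S]
    [CommRing L] [Algebra L S] {N r : ℕ} (f : Fin r → MvPolynomial (Fin N) k) (x : Fin N → S)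
    (hx : ∀ j, MvPolynomial.aeval x (f j) = 0) :
    Set.BijOn (fun (w : Fin N → S) (i : Fin N) => (inl (x i) + inr (w i) : DualNumber S))
      (LinearMap.ker ((jacobianAt f x).mulVecLin.restrictScalars L) : Set (Fin N → S))
      { b : Fin N → DualNumber S |
        (∀ j, MvPolynomial.aeval b (f j) = 0) ∧ ∀ i, fst (b i) = x i } := by
  have hmem : ∀ w : Fin N → S,
      w ∈ (LinearMap.ker ((jacobianAt f x).mulVecLin.restrictScalars L) : Set (Fin N → S)) ↔
      ∀ j, MvPolynomial.aeval (fun i => (inl (x i) + inr (w i) : DualNumber S)) (f j) = 0 := by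
    intro w
    simp only [SetLike.mem_coe, LinearMap.mem_ker, LinearMap.coe_restrictScalars,
      Matrix.mulVecLin_apply, funext_iff, MvPolynomial.aeval_inl_add_inr, hx, inl_zero, zero_add]
    exact forall_congr' fun j => (inr_injective.eq_iff' (inr_zero S)).symm
  refine ⟨fun w hw => ⟨(hmem w).1 hw, fun i => by simp⟩, fun v _ w _ h => ?_, fun b hb => ?_⟩
  · ext i
    simpa using congrArg snd (congrFun h i)
  · have hb' : (fun i => (inl (x i) + inr (snd (b i)) : DualNumber S)) = b := by
      ext i <;> simp [hb.2 i]
    exact ⟨fun i => snd (b i), (hmem _).2 (by rw [hb']; exact hb.1), hb'⟩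

/-- **Tangent space to the jet scheme at a liftable jet (Proposition 5.1).**
Let `k ⊆ L` be fields, `1 ≤ e ≤ N`, `n = N - e`, and `f 1, …, f r ∈ k[x 1, …, x N]` with
Jacobian matrix `J`. Let `α ∈ L⟦t⟧^N` satisfy `f j α = 0` for all `j` and let `β` be its
reduction modulo `t^(m+1)`. Assume every `(e+1) × (e+1)` minor of `J α` vanishes, and that
for some `a ≤ m` some `e × e` minor of `J α` has `t`-adic order `a` while every `e × e`
minor of `J α` is zero or has order at least `a`. Then (1) the kernel of the `L`-linear map
given by `J β` has `L`-dimension `n * (m+1) + a`, and (2) `w ↦ β + w ε` is a bijection from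
this kernel onto the set of `N`-tuples `b` over the dual numbers of `L[t]/(t^(m+1))` with
`f j b = 0` for all `j` and with `b` reducing to `β` modulo `ε`. -/
theorem jet_tangent_space_dim_and_bijection {k L : Type*} [Field k] [Field L] [Algebra k L]
    {N r e : ℕ} (m : ℕ) (he1 : 1 ≤ e) (heN : e ≤ N)
    (f : Fin r → MvPolynomial (Fin N) k)
    (α : Fin N → PowerSeries L)
    (hα : ∀ j, MvPolynomial.aeval α (f j) = 0)
    (hbig : ∀ d ∈ (jacobianAt f α).minorsSet (e + 1), d = 0)
    (a : ℕ) (ham : a ≤ m)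
    (hex : ∃ d ∈ (jacobianAt f α).minorsSet e, d ≠ 0 ∧ PowerSeries.order d = (a : ℕ∞))
    (hall : ∀ d ∈ (jacobianAt f α).minorsSet e,
      d = 0 ∨ (a : ℕ∞) ≤ PowerSeries.order d) :
    Module.finrank L
        (LinearMap.ker
          ((Matrix.mulVecLin (jacobianAt f (fun i => truncMod L m (α i)))).restrictScalars L)) =
      (N - e) * (m + 1) + a ∧
    Set.BijOn
      (fun (w : Fin N → Polynomial L ⧸ Ideal.span {(Polynomial.X : Polynomial L) ^ (m + 1)})
          (i : Fin N) =>
        (inl (truncMod L m (α i)) + inr (w i) :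
          DualNumber (Polynomial L ⧸ Ideal.span {(Polynomial.X : Polynomial L) ^ (m + 1)})))
      (LinearMap.ker
        ((Matrix.mulVecLin (jacobianAt f (fun i => truncMod L m (α i)))).restrictScalars L) :
        Set (Fin N → Polynomial L ⧸ Ideal.span {(Polynomial.X : Polynomial L) ^ (m + 1)}))
      { b : Fin N → DualNumber (Polynomial L ⧸ Ideal.span
            {(Polynomial.X : Polynomial L) ^ (m + 1)}) |
        (∀ j, MvPolynomial.aeval b (f j) = 0) ∧ ∀ i, fst (b i) = truncMod L m (α i) } := by
  let φ : PowerSeries L →ₐ[k]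
      Polynomial L ⧸ Ideal.span {(Polynomial.X : Polynomial L) ^ (m + 1)} :=
    { truncModHom L m with
      commutes' := fun c => by
        change Ideal.Quotient.mk _ _ = _
        rw [PowerSeries.algebraMap_apply, PowerSeries.trunc_C]
        rfl }
  have hJ : jacobianAt f (fun i => truncMod L m (α i)) =
      (jacobianAt f α).map (truncModHom L m) := jacobianAt_map f α φ
  have hβ : ∀ j, MvPolynomial.aeval (fun i => truncMod L m (α i)) (f j) = 0 := fun j => by
    have h := MvPolynomial.comp_aeval_apply α φ (f j)
    rw [hα j, map_zero] at h
    exact h.symm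
  refine ⟨?_, bijOn_ker_jacobianAt_dualNumber f _ hβ⟩
  obtain ⟨_, ⟨ρ, γ, -, -, rfl⟩, hd, hord⟩ := hex
  obtain ⟨u, hu, hdet⟩ := PowerSeries.exists_isUnit_eq_X_pow_mul hord
  obtain ⟨P, P', Q, Q', hA, hP, hQ⟩ := (jacobianAt f α).exists_factorization_submatrix ρ γ hd
    (fun x hx => by
      rw [hdet, hu.mul_right_dvd]
      rcases hall x hx with rfl | hx
      · exact dvd_zero _
      · exact PowerSeries.X_pow_dvd_iff.2 fun i hi =>
          PowerSeries.coeff_of_lt_order i (lt_of_lt_of_le (by exact_mod_cast hi) hx)) hbig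
  have hP' : P'.map (truncModHom L m) * P.map (truncModHom L m) = 1 := by
    rw [← Matrix.map_mul, hP, Matrix.map_one _ (map_zero _) (map_one _)]
  have hQ' : Q.map (truncModHom L m) * Q'.map (truncModHom L m) = 1 := by
    rw [← Matrix.map_mul, hQ, Matrix.map_one _ (map_zero _) (map_one _)]
  have key := Matrix.finrank_ker_mulVecLin_mul_mul (L := L)
    (((jacobianAt f α).submatrix ρ γ).map (truncModHom L m)) hP' hQ'
  rw [finrank_ker_mulVecLin_map_truncModHom m _ hord ham, ← Matrix.map_mul, ← Matrix.map_mul, ← hA,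
    finrank_polynomial_quotient_X_pow] at key
  rw [hJ]
  obtain ⟨n, rfl⟩ := Nat.exists_eq_add_of_le heN
  rw [Nat.add_sub_cancel_left]
  linarith
end

section
/- Let L be a field and let r, c, e, m be natural numbers with 1 ≤ e ≤ c. Let J be an r × c matrix with entries in L[[t]]. Assume: (i) every (e+1) × (e+1) minor of J is zero; (ii) there is a natural number a with a ≤ m such that some e × e minor of J has t-adic order a and every e × e minor of J is either zero or has t-adic order at least a. Let J_m be the r × c matrix over L[t]/(t^{m+1}) obtained by reducing the entries of J modulo t^{m+1}. Then the kernel of the L-linear map (L[t]/(t^{m+1}))^c → (L[t]/(t^{m+1}))^r given by J_m has dimension (c − e)(m+1) + a as an L-vector space. -/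
set_option synthInstance.maxHeartbeats 800000
set_option maxHeartbeats 1600000

open scoped PowerSeries

namespace Matrix

variable {R : Type*} [CommRing R] {r c k : ℕ}

/-- Allowing repeated rows or columns adds only the value `0` to the set of minors. -/
lemma det_submatrix_eq_zero_or_mem_minorsSet (M : Matrix (Fin r) (Fin c) R)
    (ρ : Fin k → Fin r) (γ : Fin k → Fin c) :
    (M.submatrix ρ γ).det = 0 ∨ (M.submatrix ρ γ).det ∈ M.minorsSet k := by
  by_cases hρ : Function.Injective ρ
  · by_cases hγ : Function.Injective γ
    · exact Or.inr ⟨ρ, γ, hρ, hγ, rfl⟩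
    · left
      simp only [Function.Injective, not_forall] at hγ
      obtain ⟨i, j, hij, hne⟩ := hγ
      exact det_zero_of_column_eq hne fun x => by simp [hij]
  · left
    simp only [Function.Injective, not_forall] at hρ
    obtain ⟨i, j, hij, hne⟩ := hρ
    exact det_zero_of_row_eq hne (by ext x; simp [hij])

/-- Cramer's rule: the entries of `adj(A) * B`, for `A` a square block of `B`, are minors. -/
lemma adjugate_mul_submatrix_apply (M : Matrix (Fin r) (Fin c) R)
    (ρ : Fin k → Fin r) (γ : Fin k → Fin c) (i : Fin k) (j : Fin c) :
    ((M.submatrix ρ γ).adjugate * M.submatrix ρ id) i j =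
      (M.submatrix ρ (Function.update γ i j)).det := by
  have h : ((M.submatrix ρ γ).adjugate * M.submatrix ρ id) i j =
      cramer (M.submatrix ρ γ) (fun x => M (ρ x) j) i := by
    rw [cramer_eq_adjugate_mulVec]
    rfl
  rw [h, cramer_apply]
  congr 1
  ext x y
  by_cases hy : y = i
  · subst hy; simp
  · simp [updateCol_ne hy, Function.update_of_ne hy]

/-- If the minors bordering a nonsingular block `A` vanish, the Schur complement of `A` is `0`. -/
lemma det_smul_eq_of_bordered_minors [IsDomain R] (M : Matrix (Fin r) (Fin c) R)
    (ρ : Fin k → Fin r) (γ : Fin k → Fin c) (hA : (M.submatrix ρ γ).det ≠ 0)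
    (hM : ∀ (ρ' : Fin (k + 1) → Fin r) (γ' : Fin (k + 1) → Fin c),
      (M.submatrix ρ' γ').det = 0) :
    (M.submatrix ρ γ).det • M =
      M.submatrix id γ * (M.submatrix ρ γ).adjugate * M.submatrix ρ id := by
  ext i j
  set A := M.submatrix ρ γ with hAdef
  let B : Matrix (Fin k) (Fin 1) R := M.submatrix ρ fun _ => j
  let C : Matrix (Fin 1) (Fin k) R := M.submatrix (fun _ => i) γ
  let D : Matrix (Fin 1) (Fin 1) R := M.submatrix (fun _ => i) fun _ => j
  have hN : (fromBlocks A B C D).det = 0 := by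
    have h1 : fromBlocks A B C D =
        M.submatrix (Sum.elim ρ fun _ => i) (Sum.elim γ fun _ => j) := by
      ext (x | x) (y | y) <;> rfl
    have h2 := det_submatrix_equiv_self (finSumFinEquiv (m := k) (n := 1)).symm
      (fromBlocks A B C D)
    rw [← h2, h1, submatrix_submatrix]
    exact hM _ _
  have hmul : fromBlocks A B C D *
      fromBlocks A.adjugate (-(A.adjugate * B)) 0 (A.det • (1 : Matrix (Fin 1) (Fin 1) R)) =
      fromBlocks (A.det • 1) 0 (C * A.adjugate) (A.det • D - C * A.adjugate * B) := by
    rw [fromBlocks_multiply]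
    congr 1
    · simp [mul_adjugate]
    · rw [Matrix.mul_neg, ← Matrix.mul_assoc, mul_adjugate]
      simp
    · simp
    · rw [Matrix.mul_neg, ← Matrix.mul_assoc]
      simp [sub_eq_neg_add]
  have hdet := congrArg det hmul
  rw [det_mul, hN, zero_mul, det_fromBlocks_zero₁₂, det_smul, det_one, mul_one,
    eq_comm, mul_eq_zero] at hdet
  have h0 := hdet.resolve_left (pow_ne_zero _ hA)
  rw [det_fin_one, sub_apply, sub_eq_zero] at h0
  exact h0

/-- If all `k`-minors are multiples of the nonzero minor `det A` and the `(k+1)`-minors vanish,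
then `M` factors through `A`, up to a left and a right invertible factor. -/
lemma exists_eq_mul_submatrix_mul [IsDomain R] (M : Matrix (Fin r) (Fin c) R)
    (ρ : Fin k → Fin r) (γ : Fin k → Fin c) (hA : (M.submatrix ρ γ).det ≠ 0)
    (hdvd : ∀ (ρ' : Fin k → Fin r) (γ' : Fin k → Fin c),
      (M.submatrix ρ γ).det ∣ (M.submatrix ρ' γ').det)
    (hM : ∀ (ρ' : Fin (k + 1) → Fin r) (γ' : Fin (k + 1) → Fin c),
      (M.submatrix ρ' γ').det = 0) :
    ∃ (P : Matrix (Fin r) (Fin k) R) (Q : Matrix (Fin k) (Fin c) R),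
      M = P * M.submatrix ρ γ * Q ∧ (∃ P' : Matrix (Fin k) (Fin r) R, P' * P = 1) ∧
        ∃ Q' : Matrix (Fin c) (Fin k) R, Q * Q' = 1 := by
  have key : ∀ {r c : ℕ} (M : Matrix (Fin r) (Fin c) R) (ρ : Fin k → Fin r)
      (γ : Fin k → Fin c) (_ : (M.submatrix ρ γ).det ≠ 0)
      (_ : ∀ (ρ' : Fin k → Fin r) (γ' : Fin k → Fin c),
        (M.submatrix ρ γ).det ∣ (M.submatrix ρ' γ').det),
      ∃ Q : Matrix (Fin k) (Fin c) R,
        (M.submatrix ρ γ).det • Q = (M.submatrix ρ γ).adjugate * M.submatrix ρ id ∧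
        Q * (1 : Matrix (Fin c) (Fin c) R).submatrix id γ = 1 := by
    intro r c M ρ γ hA hdvd
    choose q hq using fun i j => hdvd ρ (Function.update γ i j)
    have hQ : (M.submatrix ρ γ).det • (Matrix.of q) =
        (M.submatrix ρ γ).adjugate * M.submatrix ρ id := by
      ext i j
      rw [adjugate_mul_submatrix_apply, hq i j]
      rfl
    refine ⟨Matrix.of q, hQ, smul_right_injective _ hA ?_⟩
    change (M.submatrix ρ γ).det • _ = (M.submatrix ρ γ).det • _
    rw [← Matrix.smul_mul, hQ, Matrix.mul_assoc, ← adjugate_mul]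
    congr 1
    ext x y
    simp [Matrix.mul_apply, Matrix.one_apply]
  obtain ⟨Q, hQ, hQ1⟩ := key M ρ γ hA hdvd
  have ht : ∀ (ρ' : Fin k → Fin r) (γ' : Fin k → Fin c),
      (Mᵀ.submatrix γ' ρ').det = (M.submatrix ρ' γ').det := fun ρ' γ' => by
    rw [← transpose_submatrix, det_transpose]
  obtain ⟨P, hP, hP1⟩ := key Mᵀ γ ρ (by rwa [ht]) (fun ρ' γ' => by
    rw [ht, ht]; exact hdvd _ _)
  have hP' : (M.submatrix ρ γ).det • Pᵀ = M.submatrix id γ * (M.submatrix ρ γ).adjugate := by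
    have := congrArg transpose hP
    rw [ht, transpose_smul, transpose_mul, ← transpose_submatrix, adjugate_transpose,
      transpose_transpose] at this
    simpa using this
  refine ⟨Pᵀ, Q, ?_, ⟨_, by rw [← transpose_mul, hP1, transpose_one]⟩, ⟨_, hQ1⟩⟩
  set A := M.submatrix ρ γ with hAdef
  apply smul_right_injective _ (mul_ne_zero hA hA)
  change (A.det * A.det) • M = (A.det * A.det) • (Pᵀ * A * Q)
  calc (A.det * A.det) • M
      = A.det • (M.submatrix id γ * A.adjugate * M.submatrix ρ id) := by
        rw [mul_smul, det_smul_eq_of_bordered_minors M ρ γ hA hM]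
    _ = (M.submatrix id γ * A.adjugate) * A * (A.adjugate * M.submatrix ρ id) := by
        rw [Matrix.mul_assoc (M.submatrix id γ) A.adjugate A, adjugate_mul]
        simp [Matrix.mul_assoc]
    _ = (A.det * A.det) • (Pᵀ * A * Q) := by
        rw [← hP', ← hQ]
        simp [mul_smul]

end Matrix

namespace PowerSeries

variable {L : Type*} [Field L]

/-- The first `k` coefficients of a power series. -/
noncomputable def coeffsBelow (L : Type*) [Field L] (k : ℕ) : L⟦X⟧ →ₗ[L] (Fin k → L) :=
  LinearMap.pi fun i => coeff (i : ℕ)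

lemma coeffsBelow_surjective (k : ℕ) : Function.Surjective (coeffsBelow L k) := by
  intro v
  refine ⟨PowerSeries.mk fun n => if h : n < k then v ⟨n, h⟩ else 0, ?_⟩
  ext i
  simp [coeffsBelow]

lemma ker_coeffsBelow (k : ℕ) :
    LinearMap.ker (coeffsBelow L k) =
      (Ideal.span {(X : L⟦X⟧) ^ k}).restrictScalars L := by
  ext f
  rw [Submodule.restrictScalars_mem, Ideal.mem_span_singleton, X_pow_dvd_iff, LinearMap.mem_ker]
  constructor
  · intro h n hn
    exact congrFun h ⟨n, hn⟩
  · intro h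
    ext i
    exact h i i.2

/-- The quotient of `L⟦X⟧` by `X ^ k` as an `L`-vector space. -/
noncomputable def quotientSpanXPowEquiv (L : Type*) [Field L] (k : ℕ) :
    (L⟦X⟧ ⧸ Ideal.span {(X : L⟦X⟧) ^ k}) ≃ₗ[L] (Fin k → L) :=
  (Submodule.Quotient.restrictScalarsEquiv L (Ideal.span {(X : L⟦X⟧) ^ k})).symm ≪≫ₗ
    Submodule.quotEquivOfEq _ _ (ker_coeffsBelow k).symm ≪≫ₗ
    (coeffsBelow L k).quotKerEquivOfSurjective (coeffsBelow_surjective k)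

lemma span_singleton_eq_of_ne_zero {f : L⟦X⟧} (hf : f ≠ 0) :
    Ideal.span {f} = Ideal.span {(X : L⟦X⟧) ^ f.order.toNat} := by
  rw [Ideal.span_singleton_eq_span_singleton]
  refine ⟨(Unit_of_divided_by_X_pow_order f)⁻¹, ?_⟩
  rw [Units.mul_inv_eq_iff_eq_mul, Unit_of_divided_by_X_pow_order_nonzero hf]
  exact (X_pow_order_mul_divXPowOrder).symm

lemma finite_quotient_span_singleton {f : L⟦X⟧} (hf : f ≠ 0) :
    Module.Finite L (L⟦X⟧ ⧸ Ideal.span {f}) := by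
  rw [span_singleton_eq_of_ne_zero hf]
  exact Module.Finite.equiv (quotientSpanXPowEquiv L _).symm

lemma finrank_quotient_span_singleton {f : L⟦X⟧} (hf : f ≠ 0) :
    Module.finrank L (L⟦X⟧ ⧸ Ideal.span {f}) = f.order.toNat := by
  rw [span_singleton_eq_of_ne_zero hf, (quotientSpanXPowEquiv L _).finrank_eq,
    Module.finrank_fin_fun]

/-- The codimension of the column space of a nonsingular square matrix over `L⟦X⟧` is the order
of its determinant. -/
lemma finrank_quotient_range_mulVecLin {n : ℕ} (A : Matrix (Fin n) (Fin n) L⟦X⟧)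
    (hA : A.det ≠ 0) :
    Module.finrank L ((Fin n → L⟦X⟧) ⧸ LinearMap.range A.mulVecLin) = A.det.order.toNat := by
  have hinj : Function.Injective A.mulVecLin := by
    rw [← LinearMap.ker_eq_bot, LinearMap.ker_eq_bot']
    exact fun v hv => Matrix.eq_zero_of_mulVec_eq_zero hA hv
  let fe := LinearEquiv.ofInjective A.mulVecLin hinj
  have hrank : Module.finrank L⟦X⟧ (LinearMap.range A.mulVecLin) =
      Module.finrank L⟦X⟧ (Fin n → L⟦X⟧) := fe.finrank_eq.symm
  let b := Pi.basisFun L⟦X⟧ (Fin n)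
  let s := Submodule.smithNormalFormCoeffs b hrank
  have hs : ∀ i, s i ≠ 0 := Submodule.smithNormalFormCoeffs_ne_zero b hrank
  have hdet : Associated (∏ i, s i) A.det := by
    let b' := Submodule.smithNormalFormTopBasis b hrank
    let b'' := Submodule.smithNormalFormBotBasis b hrank
    rw [← Matrix.det_diagonal, ← LinearMap.det_toLin b', ← LinearMap.det_toLin b,
      Matrix.toLin_eq_toLin', Matrix.toLin'_apply']
    let e := (b'.equiv b'' (Equiv.refl _)).trans fe.symm
    refine LinearMap.associated_det_of_eq_comp e _ _ fun x => ?_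
    have hfe : ∀ y, A.mulVecLin (fe.symm y) = y := fun y =>
      congrArg Subtype.val (fe.apply_symm_apply y)
    have hlin : Matrix.toLin b' b' (Matrix.diagonal s) =
        (LinearMap.range A.mulVecLin).subtype ∘ₗ (b'.equiv b'' (Equiv.refl _)).toLinearMap := by
      refine b'.ext fun i => ?_
      rw [Matrix.toLin_self, LinearMap.comp_apply, LinearEquiv.coe_coe, Module.Basis.equiv_apply]
      simp [Matrix.diagonal_apply, b'', s, b']
    rw [hlin]
    exact (hfe _).symm
  have hfin : ∀ i, Module.Finite L
      (L⟦X⟧ ⧸ Ideal.span ({Submodule.smithNormalFormCoeffs b hrank i} : Set L⟦X⟧)) :=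
    fun i => finite_quotient_span_singleton (hs i)
  rw [Submodule.finrank_quotient_eq_sum L b hrank]
  rw [Finset.sum_congr rfl fun i _ => finrank_quotient_span_singleton (hs i)]
  have hord : ∀ t : Finset (Fin n),
      (∏ i ∈ t, s i).order = ((∑ i ∈ t, (s i).order.toNat : ℕ) : ℕ∞) := by
    intro t
    induction t using Finset.induction_on with
    | empty => simp
    | insert i t hi ih =>
      rw [Finset.prod_insert hi, order_mul, ih, Finset.sum_insert hi, Nat.cast_add,
        ENat.natCast_toNat (order_eq_top.not.2 (hs i))]
  obtain ⟨u, hu⟩ := hdet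
  rw [← hu, order_mul, hord, order_zero_of_unit u.isUnit, add_zero, ENat.toNat_natCast]

section Reduction

variable {S : Type*} [CommRing S] [Algebra L S] {k : ℕ}

/-- A quotient of `L⟦X⟧` by `X ^ k` as an `L`-vector space. -/
lemma nonempty_linearEquiv_of_ker_eq (φ : L⟦X⟧ →ₐ[L] S)
    (hφ : Function.Surjective φ) (hker : ∀ f, φ f = 0 ↔ (X : L⟦X⟧) ^ k ∣ f) :
    Nonempty (S ≃ₗ[L] (Fin k → L)) := by
  have h : LinearMap.ker φ.toLinearMap = LinearMap.ker (coeffsBelow L k) := by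
    ext f
    rw [ker_coeffsBelow, Submodule.restrictScalars_mem, Ideal.mem_span_singleton, ← hker]
    rfl
  exact ⟨(φ.toLinearMap.quotKerEquivOfSurjective hφ).symm ≪≫ₗ Submodule.quotEquivOfEq _ _ h ≪≫ₗ
    (coeffsBelow L k).quotKerEquivOfSurjective (coeffsBelow_surjective k)⟩

/-- If `X ^ k` is a multiple of `det A`, reduction modulo `X ^ k` does not change the cokernel. -/
lemma finrank_quotient_range_map (φ : L⟦X⟧ →ₐ[L] S)
    (hφ : Function.Surjective φ) (hker : ∀ f, φ f = 0 ↔ (X : L⟦X⟧) ^ k ∣ f)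
    {n : ℕ} (A : Matrix (Fin n) (Fin n) L⟦X⟧)
    (hA : A.det ∣ X ^ k) :
    Module.finrank L ((Fin n → S) ⧸ LinearMap.range (A.map φ).mulVecLin) =
      Module.finrank L ((Fin n → L⟦X⟧) ⧸ LinearMap.range A.mulVecLin) := by
  let N := (LinearMap.range (A.map φ).mulVecLin).restrictScalars L
  let g : (Fin n → L⟦X⟧) →ₗ[L] ((Fin n → S) ⧸ N) :=
    N.mkQ ∘ₗ LinearMap.compLeft φ.toLinearMap (Fin n)
  have hg : Function.Surjective g :=
    (Submodule.mkQ_surjective N).comp hφ.comp_left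
  have hmul : ∀ w : Fin n → L⟦X⟧, (A.map φ).mulVec (φ ∘ w) = φ ∘ A.mulVec w := fun w => by
    ext i
    exact (RingHom.map_mulVec φ.toRingHom A w i).symm
  have hgker : LinearMap.ker g = (LinearMap.range A.mulVecLin).restrictScalars L := by
    ext v
    have h1 : v ∈ LinearMap.ker g ↔ ∃ w, (A.map φ).mulVec w = φ ∘ v := by
      rw [LinearMap.mem_ker]
      exact Submodule.Quotient.mk_eq_zero N
    have h2 : v ∈ (LinearMap.range A.mulVecLin).restrictScalars L ↔ ∃ w, A.mulVec w = v :=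
      Iff.rfl
    rw [h1, h2]
    constructor
    · rintro ⟨w, hw⟩
      obtain ⟨w, rfl⟩ := hφ.comp_left w
      obtain ⟨d, hd⟩ := hA
      have h3 : ∀ i, (X : L⟦X⟧) ^ k ∣ v i - A.mulVec w i := fun i => by
        rw [← hker, map_sub, sub_eq_zero]
        exact ((congrFun (hmul w) i).symm.trans (congrFun hw i)).symm
      choose z hz using h3
      refine ⟨w + A.adjugate.mulVec (d • z), ?_⟩
      rw [Matrix.mulVec_add, Matrix.mulVec_mulVec, Matrix.mul_adjugate, Matrix.smul_mulVec,
        Matrix.one_mulVec, smul_smul, ← hd]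
      ext1 i
      rw [Pi.add_apply, Pi.smul_apply, smul_eq_mul, ← hz i, add_sub_cancel]
    · rintro ⟨w, rfl⟩
      exact ⟨φ ∘ w, hmul w⟩
  have e1 := (Submodule.Quotient.restrictScalarsEquiv L
    (LinearMap.range (A.map φ).mulVecLin)).finrank_eq
  have e2 := (Submodule.Quotient.restrictScalarsEquiv L
    (LinearMap.range A.mulVecLin)).finrank_eq
  rw [← e1, ← e2, ← hgker]
  exact (g.quotKerEquivOfSurjective hg).finrank_eq.symm

/-- The kernel of the reduction of `P * A * Q` modulo `X ^ k`. -/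
lemma finrank_ker_map_mul_mul (φ : L⟦X⟧ →ₐ[L] S)
    (hφ : Function.Surjective φ) (hker : ∀ f, φ f = 0 ↔ (X : L⟦X⟧) ^ k ∣ f)
    {r c n : ℕ} (A : Matrix (Fin n) (Fin n) L⟦X⟧)
    (hA0 : A.det ≠ 0) (hA : A.det ∣ X ^ k) (hnc : n ≤ c)
    (P : Matrix (Fin r) (Fin n) L⟦X⟧) (Q : Matrix (Fin n) (Fin c) L⟦X⟧)
    (P' : Matrix (Fin n) (Fin r) L⟦X⟧) (Q' : Matrix (Fin c) (Fin n) L⟦X⟧)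
    (hP : P' * P = 1) (hQ : Q * Q' = 1) :
    Module.finrank L
        (LinearMap.ker ((Matrix.mulVecLin ((P * A * Q).map φ)).restrictScalars L)) =
      (c - n) * k + A.det.order.toNat := by
  obtain ⟨eS⟩ := nonempty_linearEquiv_of_ker_eq φ hφ hker
  have : Module.Finite L S := Module.Finite.equiv eS.symm
  have hS : Module.finrank L S = k := by rw [eS.finrank_eq, Module.finrank_fin_fun]
  have hfun : ∀ d : ℕ, Module.finrank L (Fin d → S) = d * k := fun d => by
    rw [Module.finrank_pi_fintype]
    simp [hS]
  have hone : ∀ d : ℕ, (1 : Matrix (Fin d) (Fin d) L⟦X⟧).map φ = 1 := fun d =>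
    Matrix.map_one φ (map_zero φ) (map_one φ)
  have hP1 : P'.map φ * P.map φ = 1 := by rw [← Matrix.map_mul, hP, hone]
  have hQ1 : Q.map φ * Q'.map φ = 1 := by rw [← Matrix.map_mul, hQ, hone]
  let p := (P.map φ).mulVecLin.restrictScalars L
  let α := (A.map φ).mulVecLin.restrictScalars L
  let q := (Q.map φ).mulVecLin.restrictScalars L
  have hp : Function.Injective p := by
    refine Function.LeftInverse.injective (g := (P'.map φ).mulVec) fun v => ?_
    change (P'.map φ).mulVec ((P.map φ).mulVec v) = v
    rw [Matrix.mulVec_mulVec, hP1, Matrix.one_mulVec]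
  have hq : Function.Surjective q := by
    refine Function.RightInverse.surjective (g := (Q'.map φ).mulVec) fun v => ?_
    change (Q.map φ).mulVec ((Q'.map φ).mulVec v) = v
    rw [Matrix.mulVec_mulVec, hQ1, Matrix.one_mulVec]
  have hcomp : ((P * A * Q).map φ).mulVecLin.restrictScalars L = p ∘ₗ (α ∘ₗ q) := by
    refine LinearMap.ext fun v => ?_
    change ((P * A * Q).map φ).mulVec v =
      (P.map φ).mulVec ((A.map φ).mulVec ((Q.map φ).mulVec v))
    rw [Matrix.mulVec_mulVec, Matrix.mulVec_mulVec, Matrix.map_mul, Matrix.map_mul]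
  have h1 := (α ∘ₗ q).finrank_range_add_finrank_ker
  rw [LinearMap.range_comp_of_range_eq_top _ (LinearMap.range_eq_top.2 hq), hfun] at h1
  have h2 := (LinearMap.range α).finrank_quotient_add_finrank
  have h3 : Module.finrank L ((Fin n → S) ⧸ LinearMap.range α) = A.det.order.toNat := by
    rw [← finrank_quotient_range_mulVecLin A hA0, ← finrank_quotient_range_map φ hφ hker A hA]
    exact (Submodule.Quotient.restrictScalarsEquiv L
      (LinearMap.range (A.map φ).mulVecLin)).finrank_eq
  rw [h3, hfun] at h2
  rw [hcomp, LinearMap.ker_comp_of_ker_eq_bot _ (LinearMap.ker_eq_bot.2 hp), Nat.sub_mul]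
  have h4 : n * k ≤ c * k := Nat.mul_le_mul_right k hnc
  omega

end Reduction

end PowerSeries

section Truncation

variable (L : Type*) [Field L] (m : ℕ)

lemma truncMod_eq_zero_iff (f : L⟦X⟧) :
    truncMod L m f = 0 ↔ (PowerSeries.X : L⟦X⟧) ^ (m + 1) ∣ f := by
  rw [truncMod, Ideal.Quotient.eq_zero_iff_mem, Ideal.mem_span_singleton,
    Polynomial.X_pow_dvd_iff, PowerSeries.X_pow_dvd_iff]
  refine forall₂_congr fun d hd => ?_
  rw [PowerSeries.coeff_trunc, if_pos hd]

/-- `truncMod` as a homomorphism of `L`-algebras. -/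
noncomputable def truncModAlgHom :
    L⟦X⟧ →ₐ[L] Polynomial L ⧸ Ideal.span {(Polynomial.X : Polynomial L) ^ (m + 1)} where
  toFun := truncMod L m
  map_one' := by rw [truncMod, PowerSeries.trunc_one, map_one]
  map_zero' := by rw [truncMod, map_zero, map_zero]
  map_add' f g := by rw [truncMod, map_add, map_add]; rfl
  map_mul' f g := by
    rw [truncMod, truncMod, truncMod, ← map_mul, Ideal.Quotient.eq, Ideal.mem_span_singleton,
      Polynomial.X_pow_dvd_iff]
    intro d hd
    rw [Polynomial.coeff_sub, PowerSeries.coeff_trunc, if_pos hd,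
      PowerSeries.coeff_mul_eq_coeff_trunc_mul_trunc f g hd, ← Polynomial.coe_mul,
      Polynomial.coeff_coe, sub_self]
  commutes' x := by
    change truncMod L m (PowerSeries.C x) = _
    rw [truncMod, PowerSeries.trunc_C]
    rfl

lemma truncModAlgHom_surjective : Function.Surjective (truncModAlgHom L m) := by
  intro y
  obtain ⟨p, rfl⟩ := Ideal.Quotient.mk_surjective y
  refine ⟨(p : L⟦X⟧), ?_⟩
  change truncMod L m p = _
  rw [truncMod, Ideal.Quotient.eq, Ideal.mem_span_singleton, Polynomial.X_pow_dvd_iff]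
  intro d hd
  rw [Polynomial.coeff_sub, PowerSeries.coeff_trunc, if_pos hd, Polynomial.coeff_coe, sub_self]

end Truncation

/-- **Kernel dimension of a truncated matrix (matrix-theoretic core of Prop. 5.1).**
Let `L` be a field, `1 ≤ e ≤ c`, and `J` an `r × c` matrix over `L⟦t⟧` such that every
`(e+1) × (e+1)` minor of `J` is zero, some `e × e` minor of `J` has `t`-adic order `a ≤ m`,
and every `e × e` minor of `J` is zero or has `t`-adic order at least `a`. Then the kernel
of the `L`-linear map `(L[t]/(t^(m+1)))^c → (L[t]/(t^(m+1)))^r` given by the reduction of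
`J` modulo `t^(m+1)` has dimension `(c - e) * (m+1) + a` over `L`. -/
theorem finrank_ker_trunc_of_minors {L : Type*} [Field L] {r c e : ℕ} (m : ℕ)
    (he1 : 1 ≤ e) (hec : e ≤ c)
    (J : Matrix (Fin r) (Fin c) (PowerSeries L))
    (hbig : ∀ d ∈ J.minorsSet (e + 1), d = 0)
    (a : ℕ) (ham : a ≤ m)
    (hex : ∃ d ∈ J.minorsSet e, d ≠ 0 ∧ PowerSeries.order d = (a : ℕ∞))
    (hall : ∀ d ∈ J.minorsSet e, d = 0 ∨ (a : ℕ∞) ≤ PowerSeries.order d) :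
    Module.finrank L
        (LinearMap.ker ((Matrix.mulVecLin (J.map (truncMod L m))).restrictScalars L)) =
      (c - e) * (m + 1) + a := by
  obtain ⟨_, ⟨ρ, γ, _, _, rfl⟩, hA0, hAa⟩ := hex
  have hbig' : ∀ (ρ' : Fin (e + 1) → Fin r) (γ' : Fin (e + 1) → Fin c),
      (J.submatrix ρ' γ').det = 0 := fun ρ' γ' =>
    (J.det_submatrix_eq_zero_or_mem_minorsSet ρ' γ').elim id (hbig _)
  have hdet : Ideal.span {(J.submatrix ρ γ).det} =
      Ideal.span {(PowerSeries.X : PowerSeries L) ^ a} := by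
    rw [PowerSeries.span_singleton_eq_of_ne_zero hA0, hAa, ENat.toNat_natCast]
  have hdvd_iff : ∀ f : PowerSeries L,
      (J.submatrix ρ γ).det ∣ f ↔ (PowerSeries.X : PowerSeries L) ^ a ∣ f := fun f => by
    rw [← Ideal.mem_span_singleton, hdet, Ideal.mem_span_singleton]
  have hdvd : ∀ (ρ' : Fin e → Fin r) (γ' : Fin e → Fin c),
      (J.submatrix ρ γ).det ∣ (J.submatrix ρ' γ').det := by
    intro ρ' γ'
    rw [hdvd_iff]
    have h := (J.det_submatrix_eq_zero_or_mem_minorsSet ρ' γ').elim Or.inl (hall _)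
    rcases h with h | h
    · rw [h]
      exact dvd_zero _
    · exact PowerSeries.X_pow_dvd_iff.2 fun d hd =>
        PowerSeries.coeff_of_lt_order d (lt_of_lt_of_le (by exact_mod_cast hd) h)
  obtain ⟨P, Q, hJ, ⟨P', hP⟩, ⟨Q', hQ⟩⟩ :=
    J.exists_eq_mul_submatrix_mul ρ γ hA0 hdvd hbig'
  have hmain := PowerSeries.finrank_ker_map_mul_mul (truncModAlgHom L m)
    (truncModAlgHom_surjective L m) (truncMod_eq_zero_iff L m) (J.submatrix ρ γ) hA0
    ((hdvd_iff _).2 (pow_dvd_pow _ (by omega))) hec P Q P' Q' hP hQ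
  rw [← hJ, hAa, ENat.toNat_natCast] at hmain
  exact hmain
end
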